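/- arXiv:2105.04159 — 2 statements merged into one kernel-verified Lean document; each statement's English description precedes it below -/
import Mathlib

section
/- Let d ≤ n be nonnegative integers and let F be a k-uniform family of subsets of [n] (all members have size k) with VC-dimension of F Δ F at most d. Then |F| ≤ 2 · C(n, ⌊d/2⌋). -/
open Finset
open scoped symmDiff

def ShattersFam {n : ℕ} (F : Finset (Finset (Fin n))) (M : Finset (Fin n)) : Prop :=
  ∀ S ⊆ M, ∃ A ∈ F, A ∩ M = S

def symmDiffFam {n : ℕ} (F : Finset (Finset (Fin n))) : Finset (Finset (Fin n)) :=
  Finset.image₂ (· ∆ ·) F F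

lemma aux_expand {n : ℕ} (S T G : Finset (Fin n)) (hTS : T ⊆ S) :
    ∑ V ∈ (S \ T).powerset, (-1 : ℤ) ^ V.card * (if V ∪ T ⊆ G then 1 else 0)
      = if G ∩ S = T then 1 else 0 := by
  have h := Finset.prod_add (fun i => if i ∈ G then (-1 : ℤ) else 0) (fun _ => 1) (S \ T)
  have h2 : ∀ V : Finset (Fin n), (∏ i ∈ V, if i ∈ G then (-1 : ℤ) else 0)
      = (-1) ^ V.card * (if V ⊆ G then 1 else 0) := by
    intro V
    split_ifs with hV
    · rw [Finset.prod_congr rfl (fun i hi => if_pos (hV hi))]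
      simp
    · obtain ⟨i, hi, hiG⟩ := Finset.not_subset.1 hV
      rw [Finset.prod_eq_zero hi (if_neg hiG)]; simp
  have h3 : (∏ i ∈ S \ T, ((if i ∈ G then (-1 : ℤ) else 0) + 1))
      = if Disjoint (S \ T) G then 1 else 0 := by
    split_ifs with hD
    · apply Finset.prod_eq_one
      intro i hi
      simp [Finset.disjoint_left.1 hD hi]
    · obtain ⟨i, hi, hiG⟩ := Finset.not_disjoint_iff.1 hD
      exact Finset.prod_eq_zero hi (by simp [hiG])
  simp only [h2, h3, Finset.prod_const_one, mul_one] at h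
  by_cases hT : T ⊆ G
  · have e : ∀ V : Finset (Fin n), (V ∪ T ⊆ G) ↔ V ⊆ G := by
      intro V; rw [Finset.union_subset_iff]; tauto
    simp only [e]
    rw [← h]
    have : Disjoint (S \ T) G ↔ G ∩ S = T := by
      rw [Finset.disjoint_left]
      constructor
      · intro hh; ext i; specialize @hh i; simp only [mem_sdiff, mem_inter] at *
        have := @hT i; have := @hTS i; tauto
      · rintro rfl i hi hG; simp at hi; exact hi.2 hG
    simp only [this]
  · have e : ∀ V : Finset (Fin n), ¬ (V ∪ T ⊆ G) := by
      intro V; rw [Finset.union_subset_iff]; tauto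
    have : G ∩ S ≠ T := by
      rintro rfl; exact hT Finset.inter_subset_left
    simp [e, this]

/-- monomial on the family. -/
def monoZ {n : ℕ} (𝒢 : Finset (Finset (Fin n))) (S : Finset (Fin n)) : {G // G ∈ 𝒢} → ℤ :=
  fun G => if S ⊆ G.1 then 1 else 0

lemma mono_mem {n d : ℕ} (𝒢 : Finset (Finset (Fin n)))
    (hVC : ∀ M : Finset (Fin n), ShattersFam 𝒢 M → M.card ≤ d) (S : Finset (Fin n)) :
    monoZ 𝒢 S ∈ Submodule.span ℤ (monoZ 𝒢 '' {S | S.card ≤ d}) := by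
  induction S using Finset.strongInduction with
  | H S ih =>
  by_cases hS : S.card ≤ d
  · exact Submodule.subset_span ⟨S, hS, rfl⟩
  have hn : ¬ ShattersFam 𝒢 S := fun h => hS (hVC S h)
  unfold ShattersFam at hn
  push Not at hn
  obtain ⟨T, hTS, hT⟩ := hn
  have key : ∑ V ∈ (S \ T).powerset, (-1 : ℤ) ^ V.card • monoZ 𝒢 (V ∪ T) = 0 := by
    funext G
    have := aux_expand S T G.1 hTS
    rw [if_neg (hT G.1 G.2)] at this
    simpa [monoZ, Finset.sum_apply] using this
  rw [← Finset.add_sum_erase _ _ (Finset.mem_powerset_self (S \ T)),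
    Finset.sdiff_union_of_subset hTS] at key
  have h1 : (-1 : ℤ) ^ (S \ T).card • monoZ 𝒢 S ∈
      Submodule.span ℤ (monoZ 𝒢 '' {S | S.card ≤ d}) := by
    rw [eq_neg_of_add_eq_zero_left key]
    apply Submodule.neg_mem
    apply Submodule.sum_mem
    intro V hV
    apply Submodule.smul_mem
    apply ih
    rw [Finset.mem_erase, Finset.mem_powerset] at hV
    refine Finset.ssubset_iff_subset_ne.2
      ⟨Finset.union_subset (hV.2.trans Finset.sdiff_subset) hTS, ?_⟩
    intro he
    apply hV.1
    apply Finset.Subset.antisymm hV.2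
    intro i hi
    rw [Finset.mem_sdiff] at hi
    have : i ∈ V ∪ T := he ▸ hi.1
    rcases Finset.mem_union.1 this with h | h
    · exact h
    · exact absurd h hi.2
  have h2 := Submodule.smul_mem _ ((-1 : ℤ) ^ (S \ T).card) h1
  rwa [smul_smul, ← mul_pow, neg_one_mul, neg_neg, one_pow, one_smul] at h2

lemma delta_mem {n d : ℕ} (𝒢 : Finset (Finset (Fin n)))
    (hVC : ∀ M : Finset (Fin n), ShattersFam 𝒢 M → M.card ≤ d) :
    (fun G : {G // G ∈ 𝒢} => if G.1 = ∅ then (1 : ℤ) else 0) ∈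
      Submodule.span ℤ (monoZ 𝒢 '' {S | S.card ≤ d}) := by
  have : (fun G : {G // G ∈ 𝒢} => if G.1 = ∅ then (1 : ℤ) else 0) =
      ∑ V ∈ (univ : Finset (Fin n)).powerset, (-1 : ℤ) ^ V.card • monoZ 𝒢 V := by
    funext G
    have := aux_expand univ ∅ G.1 (Finset.empty_subset _)
    simp only [Finset.inter_univ] at this
    rw [← this]
    simp [monoZ, Finset.sum_apply]
  rw [this]
  exact Submodule.sum_mem _ fun V _ => Submodule.smul_mem _ _ (mono_mem 𝒢 hVC V)

def monoQ {n : ℕ} (F : Finset (Finset (Fin n))) (S : Finset (Fin n)) : {G // G ∈ F} → ℚ :=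
  fun G => if S ⊆ G.1 then 1 else 0

/-- Span of monomials of degree exactly `t`. -/
def Wsp {n : ℕ} (F : Finset (Finset (Fin n))) (t : ℕ) : Submodule ℚ ({G // G ∈ F} → ℚ) :=
  Submodule.span ℚ (((powersetCard t univ).image (monoQ F) : Finset _) : Set _)

lemma Wsp_finrank {n : ℕ} (F : Finset (Finset (Fin n))) (t : ℕ) :
    Module.finrank ℚ (Wsp F t) ≤ n.choose t := by
  refine (finrank_span_finset_le_card _).trans (Finset.card_image_le.trans ?_)
  simp

lemma monoQ_mem {n k t : ℕ} (F : Finset (Finset (Fin n))) (hunif : ∀ A ∈ F, A.card = k)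
    (htk : t ≤ k) (j : ℕ) : ∀ T : Finset (Fin n), T.card + j = t → monoQ F T ∈ Wsp F t := by
  induction j with
  | zero =>
    intro T hT
    apply Submodule.subset_span
    simp only [coe_image, Set.mem_image, mem_coe, mem_powersetCard]
    exact ⟨T, ⟨subset_univ _, hT⟩, rfl⟩
  | succ j ih =>
    intro T hT
    have key : ((k : ℚ) - T.card) • monoQ F T = ∑ i ∈ univ \ T, monoQ F (insert i T) := by
      funext A
      have hA := hunif A.1 A.2
      simp only [monoQ, Pi.smul_apply, Finset.sum_apply, smul_eq_mul, Finset.insert_subset_iff]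
      by_cases hTA : T ⊆ A.1
      · simp only [hTA, and_true, if_true, mul_one]
        rw [Finset.sum_boole]
        have : (univ \ T).filter (fun i => i ∈ A.1) = A.1 \ T := by
          ext i; simp; tauto
        rw [this, Finset.cast_card_sdiff hTA, hA]
      · simp [hTA]
    have hne : ((k : ℚ) - T.card) ≠ 0 := by
      have : (T.card : ℚ) < k := by exact_mod_cast (by omega : T.card < k)
      linarith
    rw [← Submodule.smul_mem_iff _ hne, key]
    apply Submodule.sum_mem
    intro i hi
    apply ih
    rw [Finset.card_insert_of_notMem (by simpa using hi)]
    omega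

def colsIn {ι : Type*} (W : Submodule ℚ (ι → ℚ)) : Submodule ℚ (Matrix ι ι ℚ) where
  carrier := {M | ∀ j, (fun i => M i j) ∈ W}
  add_mem' ha hb j := W.add_mem (ha j) (hb j)
  zero_mem' _ := W.zero_mem
  smul_mem' c _ ha j := W.smul_mem c (ha j)

def rowsIn {ι : Type*} (W : Submodule ℚ (ι → ℚ)) : Submodule ℚ (Matrix ι ι ℚ) where
  carrier := {M | ∀ i, (fun j => M i j) ∈ W}
  add_mem' ha hb j := W.add_mem (ha j) (hb j)
  zero_mem' _ := W.zero_mem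
  smul_mem' c _ ha j := W.smul_mem c (ha j)

lemma rank_good {ι : Type*} [Fintype ι] (W : Submodule ℚ (ι → ℚ)) (M : Matrix ι ι ℚ)
    (hM : M ∈ colsIn W ⊔ rowsIn W) : M.rank ≤ 2 * Module.finrank ℚ W := by
  obtain ⟨A, hA, B, hB, rfl⟩ := Submodule.mem_sup.1 hM
  have h1 : ∀ A ∈ colsIn W, A.rank ≤ Module.finrank ℚ W := by
    intro A hA
    rw [Matrix.rank_eq_finrank_span_cols]
    apply Submodule.finrank_mono
    rw [Submodule.span_le]
    rintro _ ⟨j, rfl⟩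
    exact hA j
  have h2 : B.rank ≤ Module.finrank ℚ W := by
    rw [← Matrix.rank_transpose]
    exact h1 _ hB
  have h3 : (A + B).rank ≤ A.rank + B.rank := by
    unfold Matrix.rank
    refine le_trans (Submodule.finrank_mono ?_) (Submodule.finrank_add_le_finrank_add_finrank _ _)
    rw [Matrix.mulVecLin_add]
    exact LinearMap.range_add_le _ _
  have := h1 A hA
  omega

lemma prod_good {n k t d : ℕ} (F : Finset (Finset (Fin n))) (hunif : ∀ A ∈ F, A.card = k)
    (htk : t ≤ k) (hd : d ≤ 2 * t + 1) (S : Finset (Fin n)) (hS : S.card ≤ d) :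
    (Matrix.of fun A B : {G // G ∈ F} =>
      ∏ i ∈ S, ((if i ∈ A.1 then (1 : ℚ) else 0) + (if i ∈ B.1 then 1 else 0)))
      ∈ colsIn (Wsp F t) ⊔ rowsIn (Wsp F t) := by
  have hp : ∀ (V : Finset (Fin n)) (A : {G // G ∈ F}),
      (∏ i ∈ V, if i ∈ A.1 then (1 : ℚ) else 0) = monoQ F V A := by
    intro V A
    rw [Finset.prod_boole]; rfl
  have : (Matrix.of fun A B : {G // G ∈ F} =>
      ∏ i ∈ S, ((if i ∈ A.1 then (1 : ℚ) else 0) + (if i ∈ B.1 then 1 else 0)))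
      = ∑ T ∈ S.powerset, Matrix.of fun A B : {G // G ∈ F} =>
        monoQ F T A * monoQ F (S \ T) B := by
    ext A B
    rw [Matrix.sum_apply]
    simp only [Matrix.of_apply, Finset.prod_add, hp]
  rw [this]
  apply Submodule.sum_mem
  intro T hT
  rw [Finset.mem_powerset] at hT
  have hc := Finset.card_sdiff_add_card_eq_card hT
  by_cases h : T.card ≤ t
  · apply Submodule.mem_sup_left
    intro B
    have := Submodule.smul_mem _ (monoQ F (S \ T) B)
      (monoQ_mem F hunif htk (t - T.card) T (by omega))
    convert this using 1
    funext A
    simp [mul_comm]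
  · apply Submodule.mem_sup_right
    intro A
    exact Submodule.smul_mem _ (monoQ F T A)
      (monoQ_mem F hunif htk (t - (S \ T).card) (S \ T) (by omega))

lemma lift_good {n k t d : ℕ} (F : Finset (Finset (Fin n))) (hunif : ∀ A ∈ F, A.card = k)
    (htk : t ≤ k) (hd : d ≤ 2 * t + 1) (f : {G // G ∈ symmDiffFam F} → ℤ)
    (hf : f ∈ Submodule.span ℤ (monoZ (symmDiffFam F) '' {S | S.card ≤ d})) :
    ∃ N : Matrix {G // G ∈ F} {G // G ∈ F} ℤ,
      N.map (Int.cast : ℤ → ℚ) ∈ colsIn (Wsp F t) ⊔ rowsIn (Wsp F t) ∧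
      ∀ A B, ((N A B : ℤ) : ZMod 2) =
        ((f ⟨A.1 ∆ B.1, Finset.mem_image₂_of_mem A.2 B.2⟩ : ℤ) : ZMod 2) := by
  induction hf using Submodule.span_induction with
  | mem f hf =>
    obtain ⟨S, hS, rfl⟩ := hf
    refine ⟨Matrix.of fun A B => ∏ i ∈ S, ((if i ∈ A.1 then (1 : ℤ) else 0) +
      (if i ∈ B.1 then 1 else 0)), ?_, ?_⟩
    · convert prod_good F hunif htk hd S hS using 1
      ext A B
      simp
    · intro A B
      have e : ∀ i, ((((if i ∈ A.1 then (1 : ℤ) else 0) + (if i ∈ B.1 then 1 else 0)) : ℤ) : ZMod 2)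
          = if i ∈ A.1 ∆ B.1 then 1 else 0 := by
        intro i
        by_cases h1 : i ∈ A.1 <;> by_cases h2 : i ∈ B.1 <;> simp [h1, h2, Finset.mem_symmDiff]
        decide
      rw [Matrix.of_apply, Int.cast_prod, Finset.prod_congr rfl (fun i _ => e i),
        Finset.prod_boole]
      simp only [monoZ]
      push_cast
      rfl
  | zero => exact ⟨0, by simp, by simp⟩
  | add f g _ _ hf hg =>
    obtain ⟨N, hN, hN'⟩ := hf
    obtain ⟨M, hM, hM'⟩ := hg
    refine ⟨N + M, ?_, ?_⟩
    · convert Submodule.add_mem _ hN hM using 1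
      ext; simp
    · intro A B
      simp [hN', hM']
  | smul c f _ hf =>
    obtain ⟨N, hN, hN'⟩ := hf
    refine ⟨c • N, ?_, ?_⟩
    · convert Submodule.smul_mem _ (c : ℚ) hN using 1
      ext A B
      rw [Matrix.map_apply, Matrix.smul_apply, Matrix.smul_apply, Matrix.map_apply]
      simp only [smul_eq_mul, Int.cast_mul]
    · intro A B
      rw [Matrix.smul_apply, Pi.smul_apply, smul_eq_mul, smul_eq_mul, Int.cast_mul, Int.cast_mul, hN']

theorem uniform_dvir_moran {n d k : ℕ} (hdn : d ≤ n)
    (F : Finset (Finset (Fin n))) (hunif : ∀ A ∈ F, A.card = k)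
    (hVC : ∀ M : Finset (Fin n), ShattersFam (symmDiffFam F) M → M.card ≤ d) :
    F.card ≤ 2 * n.choose (d / 2) := by
  by_cases htk : d / 2 ≤ k
  · obtain ⟨N, hN, hN'⟩ := lift_good F hunif htk (by omega) _ (delta_mem (symmDiffFam F) hVC)
    have h1 : N.map (Int.cast : ℤ → ZMod 2) = 1 := by
      ext A B
      rw [Matrix.map_apply, hN', Matrix.one_apply]
      have : A.1 ∆ B.1 = ∅ ↔ A = B := by
        rw [← Finset.bot_eq_empty, symmDiff_eq_bot, Subtype.ext_iff]
      simp only [this]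
      push_cast
      rfl
    have h2 : ((N.det : ℤ) : ZMod 2) = 1 := by
      rw [Int.cast_det, h1, Matrix.det_one]
    have h3 : N.det ≠ 0 := by
      intro h; rw [h] at h2; simp at h2
    have h4 : (N.map (Int.cast : ℤ → ℚ)).det ≠ 0 := by
      rw [← Int.cast_det]; exact_mod_cast h3
    have h5 := Matrix.rank_of_isUnit _ ((Matrix.isUnit_iff_isUnit_det _).2 h4.isUnit)
    have h6 := rank_good _ _ hN
    have h7 := Wsp_finrank F (d / 2)
    rw [h5, Fintype.card_coe] at h6
    omega
  · have h1 : F ⊆ powersetCard k univ := fun A hA =>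
      Finset.mem_powersetCard.2 ⟨subset_univ _, hunif A hA⟩
    have h2 := Finset.card_le_card h1
    rw [Finset.card_powersetCard, Finset.card_univ, Fintype.card_fin] at h2
    have h3 : n.choose k ≤ n.choose (d / 2) := by
      have hm : ∀ j, k + j ≤ n / 2 → n.choose k ≤ n.choose (k + j) := by
        intro j
        induction j with
        | zero => intro _; rfl
        | succ j ih =>
          intro h
          exact (ih (by omega)).trans (Nat.choose_le_succ_of_lt_half_left (by omega))
      have := hm (d / 2 - k) (by omega)
      rwa [Nat.add_sub_cancel' (by omega)] at this
    omega
end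

section
/- Let F be a family of subsets of [n] such that every member of F has the same cardinality k, and suppose every set shattered by F Δ F has size at most d, where d ≤ n. If d ≥ 2·min(k, n−k), then additionally |F| ≤ 2 · C(n, min(k, n−k)); in general |F| ≤ 2 · C(n, min(⌊d/2⌋, min(k, n−k))). -/
open Finset
open scoped symmDiff

/-- monomial evaluated at a set -/
def mono (R : Type) [CommRing R] {n : ℕ} (S A : Finset (Fin n)) : R :=
  ∏ i ∈ S, if i ∈ A then 1 else 0

lemma mono_eq (R : Type) [CommRing R] {n : ℕ} (S A : Finset (Fin n)) :
    mono R S A = if S ⊆ A then 1 else 0 := by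
  unfold mono
  rw [Finset.prod_ite_zero]
  simp [Finset.subset_iff]

/-- monomial evaluation matrix -/
def XM (R : Type) [CommRing R] {n : ℕ} (F : Finset (Finset (Fin n))) (m : ℕ) :
    Matrix F {S : Finset (Fin n) // S.card ≤ m} R :=
  Matrix.of fun A S => mono R S.1 A.1

lemma mono_symmDiff {n : ℕ} (M A B : Finset (Fin n)) :
    mono (ZMod 2) M (A ∆ B) = ∑ S ∈ M.powerset, mono (ZMod 2) S A * mono (ZMod 2) (M \ S) B := by
  unfold mono
  rw [← Finset.prod_add]
  refine Finset.prod_congr rfl fun i _ => ?_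
  by_cases h1 : i ∈ A <;> by_cases h2 : i ∈ B <;> simp [Finset.mem_symmDiff, h1, h2]
  decide

lemma sum_mono_all {n : ℕ} (M C : Finset (Fin n)) (i : Fin n) (hi : i ∈ M) (hC : i ∈ C) :
    ∑ T ∈ M.powerset, mono (ZMod 2) T C = 0 := by
  unfold mono
  rw [← Finset.prod_one_add]
  apply Finset.prod_eq_zero hi
  simp [hC]
  decide

lemma sum_mono_zero {n : ℕ} (S M C : Finset (Fin n)) (hS : S ⊆ M) (h : C ∩ M ≠ S) :
    ∑ T ∈ (M \ S).powerset, mono (ZMod 2) (S ∪ T) C = 0 := by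
  have key : ∀ T ∈ (M \ S).powerset, mono (ZMod 2) (S ∪ T) C
      = mono (ZMod 2) S C * mono (ZMod 2) T C := by
    intro T hT
    unfold mono
    rw [Finset.prod_union]
    rw [Finset.mem_powerset] at hT
    exact (Finset.disjoint_sdiff).mono_right hT
  rw [Finset.sum_congr rfl key, ← Finset.mul_sum]
  by_cases hSC : S ⊆ C
  · have : ∃ i ∈ M \ S, i ∈ C := by
      by_contra hcon
      push Not at hcon
      apply h
      ext i
      have := hcon i
      simp only [Finset.mem_sdiff, Finset.mem_inter] at *
      constructor
      · rintro ⟨a, b⟩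
        by_contra hh
        exact this ⟨b, hh⟩ a
      · intro a
        exact ⟨hSC a, hS a⟩
    obtain ⟨i, hi, hC⟩ := this
    rw [sum_mono_all _ _ i hi hC, mul_zero]
  · rw [mono_eq, if_neg hSC, zero_mul]

/-- matrices `X G + H Xᵀ` -/
def WW {n : ℕ} (F : Finset (Finset (Fin n))) (m : ℕ) : AddSubmonoid (Matrix F F (ZMod 2)) where
  carrier := {N | ∃ (G : Matrix {S : Finset (Fin n) // S.card ≤ m} F (ZMod 2))
    (H : Matrix F {S : Finset (Fin n) // S.card ≤ m} (ZMod 2)), N = XM (ZMod 2) F m * G + H * (XM (ZMod 2) F m).transpose}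
  zero_mem' := ⟨0, 0, by simp⟩
  add_mem' := by
    rintro a b ⟨G, H, rfl⟩ ⟨G', H', rfl⟩
    exact ⟨G + G', H + H', by rw [Matrix.mul_add, Matrix.add_mul]; abel⟩

lemma left_mem {n : ℕ} (F : Finset (Finset (Fin n))) (m : ℕ) (S : Finset (Fin n))
    (hS : S.card ≤ m) (g : F → ZMod 2) :
    (Matrix.of fun A B : F => mono (ZMod 2) S A.1 * g B) ∈ WW F m := by
  refine ⟨Matrix.of fun T B => if T = ⟨S, hS⟩ then g B else 0, 0, ?_⟩
  ext A B
  simp [Matrix.mul_apply, XM]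

lemma right_mem {n : ℕ} (F : Finset (Finset (Fin n))) (m : ℕ) (S : Finset (Fin n))
    (hS : S.card ≤ m) (g : F → ZMod 2) :
    (Matrix.of fun A B : F => g A * mono (ZMod 2) S B.1) ∈ WW F m := by
  refine ⟨0, Matrix.of fun A T => if T = ⟨S, hS⟩ then g A else 0, ?_⟩
  ext A B
  simp [Matrix.mul_apply, XM]

lemma mono_mem_s13 {n d : ℕ} (F : Finset (Finset (Fin n)))
    (hVC : ∀ M : Finset (Fin n), ShattersFam (symmDiffFam F) M → M.card ≤ d)
    (M : Finset (Fin n)) :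
    (Matrix.of fun A B : F => mono (ZMod 2) M (A.1 ∆ B.1)) ∈ WW F (d / 2) := by
  induction M using Finset.strongInduction with
  | H M ih =>
  by_cases hM : M.card ≤ d
  · have : (Matrix.of fun A B : F => mono (ZMod 2) M (A.1 ∆ B.1)) =
        ∑ S ∈ M.powerset, Matrix.of fun A B : F =>
          mono (ZMod 2) S A.1 * mono (ZMod 2) (M \ S) B.1 := by
      ext A B
      simp [Matrix.sum_apply, mono_symmDiff]
    rw [this]
    refine AddSubmonoid.sum_mem _ fun S hS => ?_
    rw [Finset.mem_powerset] at hS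
    by_cases h : S.card ≤ d / 2
    · exact left_mem F _ S h fun B => mono (ZMod 2) (M \ S) B.1
    · refine right_mem F _ (M \ S) ?_ fun A => mono (ZMod 2) S A.1
      rw [Finset.card_sdiff_of_subset hS]
      omega
  · have h1 : ¬ ShattersFam (symmDiffFam F) M := fun h => hM (hVC M h)
    unfold ShattersFam at h1
    push Not at h1
    obtain ⟨S, hS, hne⟩ := h1
    have : (Matrix.of fun A B : F => mono (ZMod 2) M (A.1 ∆ B.1)) =
        ∑ T ∈ (M \ S).powerset.erase (M \ S), Matrix.of fun A B : F =>
          mono (ZMod 2) (S ∪ T) (A.1 ∆ B.1) := by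
      ext A B
      have hz := sum_mono_zero S M (A.1 ∆ B.1) hS
        (hne _ (Finset.mem_image₂_of_mem A.2 B.2))
      rw [← Finset.add_sum_erase _ _ (Finset.mem_powerset_self (M \ S)),
        Finset.union_sdiff_of_subset hS] at hz
      simp only [Matrix.sum_apply, Matrix.of_apply]
      rw [← CharTwo.add_eq_zero]
      exact hz
    rw [this]
    refine AddSubmonoid.sum_mem _ fun T hT => ih _ ?_
    rw [Finset.mem_erase, Finset.mem_powerset] at hT
    refine Finset.ssubset_iff_subset_ne.2 ⟨Finset.union_subset hS (hT.2.trans Finset.sdiff_subset), ?_⟩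
    intro he
    apply hT.1
    refine hT.2.antisymm ?_
    intro i hi
    rw [← he] at hi
    simp at hi
    tauto

lemma one_mem_WW {n d : ℕ} (F : Finset (Finset (Fin n)))
    (hVC : ∀ M : Finset (Fin n), ShattersFam (symmDiffFam F) M → M.card ≤ d) :
    (1 : Matrix F F (ZMod 2)) ∈ WW F (d / 2) := by
  have : (1 : Matrix F F (ZMod 2)) = ∑ M : Finset (Fin n),
      Matrix.of fun A B : F => mono (ZMod 2) M (A.1 ∆ B.1) := by
    ext A B
    simp only [Matrix.sum_apply, Matrix.of_apply]
    by_cases h : A = B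
    · subst h
      simp [mono_eq, Finset.subset_empty]
    · rw [Matrix.one_apply_ne h]
      have hne : (A.1 ∆ B.1).Nonempty := by
        rw [Finset.nonempty_iff_ne_empty]
        intro h0
        exact h (Subtype.ext (symmDiff_eq_bot.1 h0))
      obtain ⟨i, hi⟩ := hne
      rw [← sum_mono_all Finset.univ _ i (Finset.mem_univ i) hi, Finset.powerset_univ]
  rw [this]
  exact AddSubmonoid.sum_mem _ fun M _ => mono_mem_s13 F hVC M

lemma rank_add_le_aux {ι : Type} [Fintype ι] (A B : Matrix ι ι (ZMod 2)) :
    (A + B).rank ≤ A.rank + B.rank := by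
  unfold Matrix.rank
  rw [Matrix.mulVecLin_add]
  refine (Submodule.finrank_mono (LinearMap.range_add_le _ _)).trans ?_
  exact Submodule.finrank_add_le_finrank_add_finrank _ _

lemma card_le_rank {n d : ℕ} (F : Finset (Finset (Fin n)))
    (hVC : ∀ M : Finset (Fin n), ShattersFam (symmDiffFam F) M → M.card ≤ d) :
    F.card ≤ 2 * (XM (ZMod 2) F (d / 2)).rank := by
  obtain ⟨G, H, h⟩ := one_mem_WW F hVC
  have h1 : (1 : Matrix F F (ZMod 2)).rank = F.card := by simp [Matrix.rank_one]
  rw [← h1, h]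
  refine (rank_add_le_aux _ _).trans ?_
  have a := Matrix.rank_mul_le_left (XM (ZMod 2) F (d / 2)) G
  have b := Matrix.rank_mul_le_right H (XM (ZMod 2) F (d / 2)).transpose
  rw [Matrix.rank_transpose] at b
  omega

lemma rank_mod_le {ι κ : Type} [Fintype ι] [Fintype κ] (Z : Matrix ι κ ℤ) :
    (Z.map (Int.cast : ℤ → ZMod 2)).rank ≤ (Z.map (Int.cast : ℤ → ℚ)).rank := by
  classical
  obtain ⟨τ, a, ha, hspan, hli⟩ := exists_linearIndependent' (ZMod 2)
    (Z.map (Int.cast : ℤ → ZMod 2)).col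
  have : Finite τ := Finite.of_injective a ha
  have := Fintype.ofFinite τ
  rw [Matrix.rank_eq_finrank_span_cols, ← hspan, finrank_span_eq_card hli]
  have hZ : LinearIndependent ℤ ((Z.map (Int.cast : ℤ → ℚ)).col ∘ a) := by
    rw [Fintype.linearIndependent_iff]
    intro g hg
    by_contra hcon
    push Not at hcon
    obtain ⟨i0, hi0⟩ := hcon
    obtain ⟨g', hg', hgcd⟩ := Finset.extract_gcd g (s := Finset.univ) ⟨i0, Finset.mem_univ _⟩
    have hd : Finset.univ.gcd g ≠ 0 := by
      intro h
      rw [Finset.gcd_eq_zero_iff] at h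
      exact hi0 (h i0 (Finset.mem_univ _))
    have hrel : ∀ r, ∑ t, g' t * Z r (a t) = 0 := by
      intro r
      have h1 := congrFun hg r
      simp only [Finset.sum_apply, Pi.smul_apply, Function.comp, Matrix.col_apply, Matrix.map_apply,
        Pi.zero_apply] at h1
      simp only [zsmul_eq_mul] at h1
      have h2 : ∑ t, g t * Z r (a t) = 0 := by exact_mod_cast h1
      have h3 : Finset.univ.gcd g * ∑ t, g' t * Z r (a t) = 0 := by
        rw [Finset.mul_sum, ← h2]
        refine Finset.sum_congr rfl fun t ht => ?_
        rw [hg' t ht, mul_assoc]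
      exact (mul_eq_zero.1 h3).resolve_left hd
    rw [Fintype.linearIndependent_iff] at hli
    have h4 := hli (fun t => (g' t : ZMod 2)) (by
      ext r
      simp only [Finset.sum_apply, Pi.smul_apply, Function.comp, Matrix.col_apply, Matrix.map_apply,
        smul_eq_mul, Pi.zero_apply]
      exact_mod_cast congrArg (Int.cast : ℤ → ZMod 2) (hrel r))
    have h5 : (2 : ℤ) ∣ Finset.univ.gcd g' := by
      refine Finset.dvd_gcd fun t _ => ?_
      exact (ZMod.intCast_zmod_eq_zero_iff_dvd _ 2).1 (h4 t)
    rw [hgcd] at h5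
    norm_num at h5
  rw [LinearIndependent.iff_fractionRing ℤ ℚ] at hZ
  rw [Matrix.rank_eq_finrank_span_cols, ← finrank_span_eq_card hZ]
  exact Submodule.finrank_mono (Submodule.span_mono (Set.range_comp_subset_range _ _))

lemma XM_map {n : ℕ} (R : Type) [CommRing R] (F : Finset (Finset (Fin n))) (m : ℕ) :
    (XM ℤ F m).map (Int.cast : ℤ → R) = XM R F m := by
  ext A S
  simp only [XM, Matrix.map_apply, Matrix.of_apply, mono_eq]
  split_ifs <;> simp

lemma count {n m : ℕ} (S A : Finset (Fin n)) (hS : S ⊆ A) (hm : S.card ≤ m) :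
    ((Finset.powersetCard m (Finset.univ : Finset (Fin n))).filter
      (fun T => S ⊆ T ∧ T ⊆ A)).card = (A.card - S.card).choose (m - S.card) := by
  rw [← Finset.card_sdiff_of_subset hS, ← Finset.card_powersetCard]
  symm
  refine Finset.card_bij' (fun T _ => S ∪ T) (fun T _ => T \ S) ?_ ?_ ?_ ?_
  · intro T hT
    rw [Finset.mem_powersetCard] at hT
    have hd : Disjoint S T := (Finset.disjoint_sdiff).mono_right hT.1
    simp only [Finset.mem_filter, Finset.mem_powersetCard, Finset.subset_univ, true_and]
    refine ⟨?_, Finset.subset_union_left, Finset.union_subset hS (hT.1.trans Finset.sdiff_subset)⟩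
    rw [Finset.card_union_of_disjoint hd, hT.2]
    omega
  · intro T hT
    simp only [Finset.mem_filter, Finset.mem_powersetCard, Finset.subset_univ, true_and] at hT
    rw [Finset.mem_powersetCard, Finset.card_sdiff_of_subset hT.2.1, hT.1]
    exact ⟨Finset.sdiff_subset_sdiff hT.2.2 (Finset.Subset.refl _), rfl⟩
  · intro T hT
    rw [Finset.mem_powersetCard] at hT
    have hd : Disjoint S T := (Finset.disjoint_sdiff).mono_right hT.1
    exact Finset.union_sdiff_cancel_left hd
  · intro T hT
    simp only [Finset.mem_filter] at hT
    exact Finset.union_sdiff_of_subset hT.2.1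

lemma rank_rat {n m k : ℕ} (F : Finset (Finset (Fin n))) (hunif : ∀ A ∈ F, A.card = k)
    (hm : m ≤ k) : (XM ℚ F m).rank ≤ n.choose m := by
  have h : XM ℚ F m =
      (Matrix.of fun (A : F) (T : Finset.powersetCard m (Finset.univ : Finset (Fin n))) =>
        mono ℚ T.1 A.1) *
      (Matrix.of fun (T : Finset.powersetCard m (Finset.univ : Finset (Fin n)))
        (S : {S : Finset (Fin n) // S.card ≤ m}) => mono ℚ S.1 T.1 / ((k - S.1.card).choose (m - S.1.card) : ℚ)) := by
    ext A S
    rw [Matrix.mul_apply]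
    simp only [Matrix.of_apply, XM]
    rw [Finset.sum_coe_sort (Finset.powersetCard m (Finset.univ : Finset (Fin n)))
      (fun T => mono ℚ T A.1 *
        (mono ℚ S.1 T / ((k - S.1.card).choose (m - S.1.card) : ℚ)))]
    have hpos : ((k - S.1.card).choose (m - S.1.card) : ℚ) ≠ 0 := by
      exact_mod_cast (Nat.choose_pos (by omega)).ne'
    simp only [← mul_div_assoc]
    rw [← Finset.sum_div, eq_div_iff hpos]
    have hs : ∀ T : Finset (Fin n), mono ℚ T A.1 * mono ℚ S.1 T =
        if S.1 ⊆ T ∧ T ⊆ A.1 then 1 else 0 := by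
      intro T
      simp only [mono_eq]
      by_cases h1 : S.1 ⊆ T <;> by_cases h2 : T ⊆ A.1 <;> simp [h1, h2]
    simp only [hs]
    rw [Finset.sum_boole, mono_eq]
    split_ifs with hSA
    · rw [count S.1 A.1 hSA S.2, hunif _ A.2, one_mul]
    · rw [zero_mul, eq_comm, Nat.cast_eq_zero, Finset.card_eq_zero, Finset.filter_eq_empty_iff]
      rintro T - ⟨a, b⟩
      exact hSA (a.trans b)
  rw [h]
  refine (Matrix.rank_mul_le_left _ _).trans ((Matrix.rank_le_card_width _).trans ?_)
  simp

theorem uniform_dvir_moran_refined {n d k : ℕ} (hdn : d ≤ n)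
    (F : Finset (Finset (Fin n))) (hunif : ∀ A ∈ F, A.card = k)
    (hVC : ∀ M : Finset (Fin n), ShattersFam (symmDiffFam F) M → M.card ≤ d) :
    (2 * min k (n - k) ≤ d → F.card ≤ 2 * n.choose (min k (n - k))) ∧
    F.card ≤ 2 * n.choose (min (d / 2) (min k (n - k))) := by
  rcases F.eq_empty_or_nonempty with rfl | ⟨A0, hA0⟩
  · simp
  have hkn : k ≤ n := by
    rw [← hunif A0 hA0]
    simpa using Finset.card_le_univ A0
  have htriv : F.card ≤ n.choose (min k (n - k)) := by
    have h1 : F.card ≤ n.choose k := by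
      have : F ⊆ Finset.powersetCard k Finset.univ := fun A hA => by
        simp [Finset.mem_powersetCard, hunif A hA]
      simpa using Finset.card_le_card this
    rcases le_total k (n - k) with h | h
    · rwa [min_eq_left h]
    · rwa [min_eq_right h, Nat.choose_symm hkn]
  refine ⟨fun _ => by omega, ?_⟩
  rcases le_total (min k (n - k)) (d / 2) with h | h
  · rw [min_eq_right h]
    omega
  · rw [min_eq_left h]
    refine (card_le_rank F hVC).trans (Nat.mul_le_mul_left 2 ?_)
    rw [← XM_map (ZMod 2)]
    refine (rank_mod_le _).trans ?_
    rw [XM_map ℚ]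
    exact rank_rat F hunif (h.trans (min_le_left _ _))
end
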